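/- arXiv:2010.10505 — 2 statements merged into one kernel-verified Lean document; each statement's English description precedes it below -/
import Mathlib

section
/- Let u ∈ ℝ² with u ≠ 0, d > 0, and z ≥ 1. Then every point p ∈ ℝ³ lying outside the back-projected solid cone C(u,d) satisfies ‖z·ū − p‖ ≥ b(z;u,d); equivalently, the open Euclidean ball of radius b(z;u,d) centered at z·ū is contained in C(u,d) (the sphere of radius b(z;u,d) centered at z·ū is inscribed in the cone). -/
open RealInnerProductSpace

/-- Homogeneous lift of a 2D point `u` to `ū = (u₁, u₂, 1) ∈ ℝ³`. -/
noncomputable def homLift (u : EuclideanSpace ℝ (Fin 2)) : EuclideanSpace ℝ (Fin 3) :=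
  (WithLp.equiv 2 (Fin 3 → ℝ)).symm ![u 0, u 1, 1]

/-- The SDF lower bound `b(z; u, d) = z‖ū − (⟨v̄,ū⟩/⟨v̄,v̄⟩)v̄‖` with `v = (1 + d/‖u‖)u`. -/
noncomputable def lowerBound (z : ℝ) (u : EuclideanSpace ℝ (Fin 2)) (d : ℝ) : ℝ :=
  z * ‖homLift u - ((⟪homLift ((1 + d / ‖u‖) • u), homLift u⟫ : ℝ) /
        (⟪homLift ((1 + d / ‖u‖) • u), homLift ((1 + d / ‖u‖) • u)⟫ : ℝ)) •
        homLift ((1 + d / ‖u‖) • u)‖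

/-- The back-projected solid cone `C(u,d) = { t • w̄ : t ≥ 0, ‖w − u‖ ≤ d }`. -/
def backCone (u : EuclideanSpace ℝ (Fin 2)) (d : ℝ) : Set (EuclideanSpace ℝ (Fin 3)) :=
  {x | ∃ t : ℝ, 0 ≤ t ∧ ∃ w : EuclideanSpace ℝ (Fin 2), ‖w - u‖ ≤ d ∧ x = t • homLift w}

theorem inner_homLift (a b : EuclideanSpace ℝ (Fin 2)) :
    (⟪homLift a, homLift b⟫ : ℝ) = ⟪a, b⟫ + 1 := by
  simp [homLift, PiLp.inner_apply, Fin.sum_univ_three, Fin.sum_univ_two]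

theorem norm_sub_inner_div_smul_sq_mul {E : Type*} [NormedAddCommGroup E]
    [InnerProductSpace ℝ E] (x y : E) (hy : (⟪y, y⟫ : ℝ) ≠ 0) :
    ‖x - ((⟪y, x⟫ : ℝ) / ⟪y, y⟫) • y‖ ^ 2 * ⟪y, y⟫ = ⟪x, x⟫ * ⟪y, y⟫ - ⟪y, x⟫ ^ 2 := by
  rw [← real_inner_self_eq_norm_sq]
  simp only [inner_sub_left, inner_sub_right, real_inner_smul_left, real_inner_smul_right,
    real_inner_comm y x]
  field_simp
  ring

theorem lowerBound_sq_mul (z : ℝ) {u : EuclideanSpace ℝ (Fin 2)} (hu : u ≠ 0) (d : ℝ) :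
    lowerBound z u d ^ 2 * ((‖u‖ + d) ^ 2 + 1) = (z * d) ^ 2 := by
  have hr : ‖u‖ ≠ 0 := norm_ne_zero_iff.mpr hu
  set v := (1 + d / ‖u‖) • u with hv
  have huu : (⟪homLift u, homLift u⟫ : ℝ) = ‖u‖ ^ 2 + 1 := by
    rw [inner_homLift, real_inner_self_eq_norm_sq]
  have hvu : (⟪homLift v, homLift u⟫ : ℝ) = (‖u‖ + d) * ‖u‖ + 1 := by
    rw [inner_homLift, hv, real_inner_smul_left, real_inner_self_eq_norm_sq]
    field_simp
  have hvv : (⟪homLift v, homLift v⟫ : ℝ) = (‖u‖ + d) ^ 2 + 1 := by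
    rw [inner_homLift, hv, real_inner_smul_left, real_inner_smul_right,
      real_inner_self_eq_norm_sq]
    field_simp
  have key := norm_sub_inner_div_smul_sq_mul (homLift u) (homLift v) (by rw [hvv]; positivity)
  rw [lowerBound, ← hvv, mul_pow, mul_assoc, ← hv, key, huu, hvu, hvv]
  ring

theorem mem_backCone_of_norm_sub_le {u : EuclideanSpace ℝ (Fin 2)} {d : ℝ}
    {p : EuclideanSpace ℝ (Fin 3)} (hp : 0 < p 2) (h : ‖!₂[p 0, p 1] - p 2 • u‖ ≤ p 2 * d) :
    p ∈ backCone u d := by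
  refine ⟨p 2, hp.le, (p 2)⁻¹ • !₂[p 0, p 1], ?_, ?_⟩
  · have hw : (p 2)⁻¹ • !₂[p 0, p 1] - u = (p 2)⁻¹ • (!₂[p 0, p 1] - p 2 • u) := by
      rw [smul_sub, inv_smul_smul₀ hp.ne']
    rw [hw, norm_smul, norm_inv, Real.norm_of_nonneg hp.le]
    exact (inv_mul_le_iff₀ hp).mpr h
  · ext i
    fin_cases i <;> simp [homLift, hp.ne']

theorem norm_smul_homLift_sub_sq (z : ℝ) (u : EuclideanSpace ℝ (Fin 2))
    (p : EuclideanSpace ℝ (Fin 3)) :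
    ‖z • homLift u - p‖ ^ 2 = ‖!₂[p 0, p 1] - z • u‖ ^ 2 + (p 2 - z) ^ 2 := by
  simp [EuclideanSpace.real_norm_sq_eq, Fin.sum_univ_three, Fin.sum_univ_two, homLift]
  ring

theorem mem_backCone_of_norm_sub_lt {u : EuclideanSpace ℝ (Fin 2)} (hu : u ≠ 0) {d : ℝ}
    (hd : 0 < d) {z : ℝ} (hz : 0 < z) {p : EuclideanSpace ℝ (Fin 3)}
    (h : ‖z • homLift u - p‖ < lowerBound z u d) : p ∈ backCone u d := by
  have hsq : ‖z • homLift u - p‖ ^ 2 < lowerBound z u d ^ 2 :=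
    pow_lt_pow_left₀ h (norm_nonneg _) two_ne_zero
  have hb := lowerBound_sq_mul z hu d
  rw [norm_smul_homLift_sub_sq] at hsq
  set q := !₂[p 0, p 1] - z • u with hq
  set s := ‖u‖ + d with hs
  have hds : d ≤ s := le_add_of_nonneg_left (norm_nonneg u)
  have hlt : (‖q‖ ^ 2 + |p 2 - z| ^ 2) * (s ^ 2 + 1) < (z * d) ^ 2 := by
    rw [← hb, sq_abs]
    exact mul_lt_mul_of_pos_right hsq (by positivity)
  have hsum : ‖q‖ + |p 2 - z| * s < z * d := by
    refine lt_of_pow_lt_pow_left₀ 2 (by positivity) (lt_of_le_of_lt ?_ hlt)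
    linarith [sq_nonneg (‖q‖ * s - |p 2 - z|)]
  have hpos : 0 < p 2 := by
    have : |p 2 - z| * d < z * d := by
      linarith [norm_nonneg q, mul_le_mul_of_nonneg_left hds (abs_nonneg (p 2 - z))]
    linarith [neg_abs_le (p 2 - z), lt_of_mul_lt_mul_right this hd.le]
  refine mem_backCone_of_norm_sub_le hpos ?_
  calc ‖!₂[p 0, p 1] - p 2 • u‖ = ‖q - (p 2 - z) • u‖ := by rw [hq, sub_smul]; abel_nf
    _ ≤ ‖q‖ + |p 2 - z| * ‖u‖ := by
      simpa [norm_smul] using norm_sub_le q ((p 2 - z) • u)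
    _ ≤ p 2 * d := by
      linarith [mul_le_mul_of_nonneg_right (neg_abs_le (p 2 - z)) hd.le,
        mul_add |p 2 - z| ‖u‖ d]

/-- every point outside the back-projected cone is at distance at least
`b(z;u,d)` from `z • ū`; equivalently the open ball of radius `b(z;u,d)` centered at
`z • ū` is contained in the cone. -/
theorem ball_subset_backCone
    (u : EuclideanSpace ℝ (Fin 2)) (hu : u ≠ 0) (d : ℝ) (hd : 0 < d)
    (z : ℝ) (hz : 1 ≤ z) :
    (∀ p : EuclideanSpace ℝ (Fin 3), p ∉ backCone u d →
        ‖z • homLift u - p‖ ≥ lowerBound z u d) ∧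
    Metric.ball (z • homLift u) (lowerBound z u d) ⊆ backCone u d := by
  have hz0 : 0 < z := one_pos.trans_le hz
  refine ⟨fun p hp => ?_, fun p hp => ?_⟩
  · by_contra! h
    exact hp (mem_backCone_of_norm_sub_lt hu hd hz0 h)
  · rw [Metric.mem_ball', dist_eq_norm] at hp
    exact mem_backCone_of_norm_sub_lt hu hd hz0 hp
end

section
/- Let u = (u₁,u₂) ∈ ℝ² with u ≠ 0, let d > 0, z' > 0, and z ∈ ℝ with z ≠ z'. Define g : ℝ → ℝ by g(θ) = ‖z·ū − z'·(u₁ + d·cos θ, u₂ + d·sin θ, 1)‖². Then θ is a critical point of g (i.e. g'(θ) = 0) if and only if u₁·sin θ = u₂·cos θ, i.e. if and only if (cos θ, sin θ) = u/‖u‖ or (cos θ, sin θ) = −u/‖u‖. -/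
open RealInnerProductSpace

/-- The derivative of the squared distance from `z • ū` to `z'` times the lift of the point at
angle `θ` on the circle of radius `d` centred at `u`. -/
theorem hasDerivAt_sq_norm_smul_homLift_sub_circle
    (u : EuclideanSpace ℝ (Fin 2)) (d z z' θ : ℝ) :
    HasDerivAt
      (fun θ : ℝ => ‖z • homLift u -
        z' • ((WithLp.equiv 2 (Fin 3 → ℝ)).symm
          ![u 0 + d * Real.cos θ, u 1 + d * Real.sin θ, 1])‖ ^ 2)
      (2 * z' * d * (z - z') * (u 0 * Real.sin θ - u 1 * Real.cos θ)) θ := by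
  have hexpand : (fun θ : ℝ => ‖z • homLift u -
      z' • ((WithLp.equiv 2 (Fin 3 → ℝ)).symm
        ![u 0 + d * Real.cos θ, u 1 + d * Real.sin θ, 1])‖ ^ 2) =
      fun θ : ℝ => (z * u 0 - z' * (u 0 + d * Real.cos θ)) ^ 2 +
        (z * u 1 - z' * (u 1 + d * Real.sin θ)) ^ 2 + (z - z') ^ 2 := by
    funext θ
    simp [EuclideanSpace.norm_sq_eq, Fin.sum_univ_three, homLift]
  rw [hexpand]
  have hcos := (((((Real.hasDerivAt_cos θ).const_mul d).const_add (u 0)).const_mul z').const_sub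
    (z * u 0)).pow 2
  have hsin := (((((Real.hasDerivAt_sin θ).const_mul d).const_add (u 1)).const_mul z').const_sub
    (z * u 1)).pow 2
  refine ((hcos.add hsin).add_const ((z - z') ^ 2)).congr_deriv ?_
  push_cast
  ring

/-- A nonzero planar vector is collinear with the unit vector at angle `θ` exactly when that unit
vector is one of its two normalizations. -/
theorem mul_sin_eq_mul_cos_iff_eq_normalize_or_neg
    (u : EuclideanSpace ℝ (Fin 2)) (hu : u ≠ 0) (θ : ℝ) :
    u 0 * Real.sin θ = u 1 * Real.cos θ ↔
      ((WithLp.equiv 2 (Fin 2 → ℝ)).symm ![Real.cos θ, Real.sin θ]) = ‖u‖⁻¹ • u ∨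
      ((WithLp.equiv 2 (Fin 2 → ℝ)).symm ![Real.cos θ, Real.sin θ]) = -(‖u‖⁻¹ • u) := by
  have hn : ‖u‖ ≠ 0 := norm_ne_zero_iff.mpr hu
  have hnorm : ‖u‖ ^ 2 = u 0 ^ 2 + u 1 ^ 2 := by
    simp [EuclideanSpace.norm_sq_eq, Fin.sum_univ_two]
  have hunit := Real.sin_sq_add_cos_sq θ
  have hcoord (v : EuclideanSpace ℝ (Fin 2)) :
      (WithLp.equiv 2 (Fin 2 → ℝ)).symm ![Real.cos θ, Real.sin θ] = v ↔
        Real.cos θ = v 0 ∧ Real.sin θ = v 1 := by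
    rw [PiLp.ext_iff, Fin.forall_fin_two]
    simp
  simp only [hcoord, PiLp.neg_apply, PiLp.smul_apply, smul_eq_mul]
  constructor
  · intro h
    have h0 : u 0 = (u 0 * Real.cos θ + u 1 * Real.sin θ) * Real.cos θ := by
      linear_combination (-u 0) * hunit + Real.sin θ * h
    have h1 : u 1 = (u 0 * Real.cos θ + u 1 * Real.sin θ) * Real.sin θ := by
      linear_combination (-u 1) * hunit - Real.cos θ * h
    generalize u 0 * Real.cos θ + u 1 * Real.sin θ = t at h0 h1
    have ht : ‖u‖ ^ 2 = t ^ 2 := by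
      rw [hnorm, h0, h1]
      linear_combination t ^ 2 * hunit
    rcases sq_eq_sq_iff_eq_or_eq_neg.mp ht with h | h
    · left
      rw [h0, h1, ← h]
      constructor <;> field_simp
    · right
      rw [h0, h1, show t = -‖u‖ by linarith]
      constructor <;> field_simp
  · rintro (⟨hc, hs⟩ | ⟨hc, hs⟩) <;> rw [hc, hs] <;> ring

/-- first-order optimality condition on `θ`: for `u ≠ 0`, `d > 0`, `z' > 0`,
`z ≠ z'`, the derivative of `g(θ) = ‖z • ū − z' • (u₁ + d cos θ, u₂ + d sin θ, 1)‖²`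
vanishes iff `u₁ sin θ = u₂ cos θ`, iff `(cos θ, sin θ) = ±u/‖u‖`. -/
theorem critical_point_iff_collinear
    (u : EuclideanSpace ℝ (Fin 2)) (hu : u ≠ 0) (d : ℝ) (hd : 0 < d)
    (z' : ℝ) (hz' : 0 < z') (z : ℝ) (hzz : z ≠ z') :
    ∀ θ : ℝ,
      (deriv
          (fun θ : ℝ => ‖z • homLift u -
            z' • ((WithLp.equiv 2 (Fin 3 → ℝ)).symm
              ![u 0 + d * Real.cos θ, u 1 + d * Real.sin θ, 1])‖ ^ 2) θ = 0
        ↔ u 0 * Real.sin θ = u 1 * Real.cos θ) ∧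
      (deriv
          (fun θ : ℝ => ‖z • homLift u -
            z' • ((WithLp.equiv 2 (Fin 3 → ℝ)).symm
              ![u 0 + d * Real.cos θ, u 1 + d * Real.sin θ, 1])‖ ^ 2) θ = 0
        ↔ (((WithLp.equiv 2 (Fin 2 → ℝ)).symm ![Real.cos θ, Real.sin θ]) = ‖u‖⁻¹ • u ∨
           ((WithLp.equiv 2 (Fin 2 → ℝ)).symm ![Real.cos θ, Real.sin θ]) = -(‖u‖⁻¹ • u))) := by
  intro θ
  have hcrit : deriv
      (fun θ : ℝ => ‖z • homLift u -
        z' • ((WithLp.equiv 2 (Fin 3 → ℝ)).symm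
          ![u 0 + d * Real.cos θ, u 1 + d * Real.sin θ, 1])‖ ^ 2) θ = 0
      ↔ u 0 * Real.sin θ = u 1 * Real.cos θ := by
    rw [(hasDerivAt_sq_norm_smul_homLift_sub_circle u d z z' θ).deriv, mul_eq_zero, sub_eq_zero]
    have hne : 2 * z' * d * (z - z') ≠ 0 :=
      mul_ne_zero (by positivity) (sub_ne_zero.mpr hzz)
    exact or_iff_right hne
  exact ⟨hcrit, hcrit.trans (mul_sin_eq_mul_cos_iff_eq_normalize_or_neg u hu θ)⟩
end
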